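/- arXiv:1301.4805 — 4 statements merged into one kernel-verified Lean document; each statement's English description precedes it below -/
import Mathlib

section
/- Let L be a Lie ring and Θ ∈ L an element such that ⁅⁅x,Θ⁆,Θ⁆ = 0 for every x ∈ L. Then the derived bracket x∘y := ⁅⁅x,Θ⁆,y⁆ satisfies the left Leibniz identity: x∘(y∘z) = (x∘y)∘z + y∘(x∘z) for all x, y, z ∈ L. -/
/-- If `Θ` in a Lie ring satisfies `⁅⁅x,Θ⁆,Θ⁆ = 0` for all `x` (the classical
master equation), then the derived bracket `x ∘ y := ⁅⁅x,Θ⁆,y⁆` satisfies the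
left Leibniz identity. -/
theorem derived_bracket_leibniz {L : Type*} [LieRing L] (Θ : L)
    (hΘ : ∀ x : L, ⁅⁅x, Θ⁆, Θ⁆ = 0) :
    ∀ x y z : L,
      ⁅⁅x, Θ⁆, ⁅⁅y, Θ⁆, z⁆⁆ = ⁅⁅⁅⁅x, Θ⁆, y⁆, Θ⁆, z⁆ + ⁅⁅y, Θ⁆, ⁅⁅x, Θ⁆, z⁆⁆ := by
  intro x y z
  have h : ⁅⁅⁅x, Θ⁆, y⁆, Θ⁆ = ⁅⁅x, Θ⁆, ⁅y, Θ⁆⁆ := by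
    rw [lie_lie ⁅x, Θ⁆ y Θ, hΘ x, lie_zero, sub_zero]
  rw [h]
  exact leibniz_lie ⁅x, Θ⁆ ⁅y, Θ⁆ z
end

section
/- Let V be a vector space over a field of characteristic zero with a bilinear bracket ⁅·,·⁆ satisfying the left Leibniz identity ⁅x,⁅y,z⁆⁆ = ⁅⁅x,y⁆,z⁆ + ⁅y,⁅x,z⁆⁆ (the bracket is not assumed antisymmetric). Let D : V → V be a nilpotent linear derivation of the bracket, D^N = 0, and set E := Σ_{k=0}^{N−1} (1/k!) D^k. If Θ ∈ V satisfies the classical master equation ⁅Θ,Θ⁆ = 0, then the transformed element Θ' := EΘ also satisfies ⁅Θ',Θ'⁆ = 0. -/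
/-- A canonical transformation (the exponential of a nilpotent derivation of a
left Leibniz bracket) preserves the classical master equation: if `⁅Θ,Θ⁆ = 0`
then `⁅EΘ,EΘ⁆ = 0`, where `E = ∑_{k<N} (1/k!) D^k` with `D` a derivation of the
bracket and `D ^ N = 0`. -/
theorem canonical_transformation_preserves_master_equation {K : Type*} [Field K]
    [CharZero K] {V : Type*} [AddCommGroup V] [Module K V]
    (br : V →ₗ[K] V →ₗ[K] V)
    (h_leibniz : ∀ x y z : V, br x (br y z) = br (br x y) z + br y (br x z))
    (D : V →ₗ[K] V)
    (h_deriv : ∀ x y : V, D (br x y) = br (D x) y + br x (D y))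
    (N : ℕ) (h_nil : D ^ N = 0)
    (Θ : V) (hΘ : br Θ Θ = 0) :
    br ((∑ k ∈ Finset.range N, ((k.factorial : K)⁻¹) • (D ^ k)) Θ)
      ((∑ k ∈ Finset.range N, ((k.factorial : K)⁻¹) • (D ^ k)) Θ) = 0 := by
  let : Module ℚ V := Module.compHom V (algebraMap ℚ K)
  have hq : ∀ (q : ℚ) (v : V), q • v = (q : K) • v := fun _ _ => rfl
  let R : NonUnitalNonAssocRing V :=
    { (inferInstance : AddCommGroup V) with
      mul := fun x y => br x y
      left_distrib := fun x y z => (br x).map_add y z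
      right_distrib := fun x y z => by
        change br (x + y) z = br x z + br y z
        simp
      zero_mul := fun x => by
        change br 0 x = 0
        simp
      mul_zero := fun x => (br x).map_zero }
  have hmul : ∀ x y : V, x * y = br x y := fun _ _ => rfl
  have : SMulCommClass K V V := ⟨fun c x y => ((br x).map_smul c y).symm⟩
  have : IsScalarTower K V V := ⟨fun c x y => by
    change br (c • x) y = c • br x y
    simp⟩
  have hE : IsNilpotent.exp D = ∑ k ∈ Finset.range N, ((k.factorial : K)⁻¹) • (D ^ k) := by
    rw [IsNilpotent.exp_eq_sum h_nil]
    refine Finset.sum_congr rfl fun k _ => ?_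
    ext v
    rw [LinearMap.smul_apply, LinearMap.smul_apply, hq]
    simp
  have key := Module.End.exp_mul_of_derivation K V D
    (fun x y => (h_deriv x y).trans (add_comm _ _)) ⟨N, h_nil⟩ Θ Θ
  rw [hE, hmul, hmul, hΘ, map_zero] at key
  exact key.symm
end

section
/- Let (L,∘) be a left Leibniz algebra, i.e. ∘ is bilinear and satisfies x∘(y∘z) = (x∘y)∘z + y∘(x∘z) for all x,y,z, and let α ∈ L satisfy (x∘α)∘α = 0 for every x ∈ L. Then the derived bracket x•y := (x∘α)∘y again satisfies the left Leibniz identity: x•(y•z) = (x•y)•z + y•(x•z) for all x, y, z ∈ L. -/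
/-- In a left Leibniz algebra `(L, ∘)`, if `α` satisfies `(x ∘ α) ∘ α = 0` for
all `x`, then the derived bracket `x • y := (x ∘ α) ∘ y` again satisfies the
left Leibniz identity. -/
theorem derived_of_leibniz_is_leibniz {L : Type*} [AddCommGroup L]
    (op : L → L → L)
    (h_add_left : ∀ x y z : L, op (x + y) z = op x z + op y z)
    (h_add_right : ∀ x y z : L, op x (y + z) = op x y + op x z)
    (h_leibniz : ∀ x y z : L, op x (op y z) = op (op x y) z + op y (op x z))
    (α : L) (hα : ∀ x : L, op (op x α) α = 0) :
    ∀ x y z : L,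
      op (op x α) (op (op y α) z) =
        op (op (op (op x α) y) α) z + op (op y α) (op (op x α) z) := by
  intro x y z
  have h0 : op y 0 = 0 := by
    have h := h_add_right y 0 0
    rw [add_zero] at h
    exact left_eq_add.mp h
  have h1 : op (op x α) (op y α) = op (op (op x α) y) α := by
    rw [h_leibniz (op x α) y α, hα x, h0, add_zero]
  rw [h_leibniz (op x α) (op y α) z, h1]
end

section
/- Let (L,∘) be a left Leibniz algebra, i.e. ∘ is bilinear and satisfies x∘(y∘z) = (x∘y)∘z + y∘(x∘z) for all x,y,z, let α ∈ L be arbitrary, and define x•y := (x∘α)∘y. Then for all x, y, z ∈ L the failure of the left Leibniz identity for • is given exactly by x•(y•z) − (x•y)•z − y•(x•z) = (y∘((x∘α)∘α))∘z. -/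
/-- In a left Leibniz algebra `(L, ∘)` with an arbitrary element `α`, the
failure of the left Leibniz identity for the derived bracket
`x • y := (x ∘ α) ∘ y` is measured exactly by the square of `α`:
`x•(y•z) − (x•y)•z − y•(x•z) = (y ∘ ((x∘α)∘α)) ∘ z`. -/
theorem derived_bracket_anomaly {L : Type*} [AddCommGroup L]
    (op : L → L → L)
    (h_add_left : ∀ x y z : L, op (x + y) z = op x z + op y z)
    (h_add_right : ∀ x y z : L, op x (y + z) = op x y + op x z)
    (h_leibniz : ∀ x y z : L, op x (op y z) = op (op x y) z + op y (op x z))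
    (α : L) :
    ∀ x y z : L,
      op (op x α) (op (op y α) z) - op (op (op (op x α) y) α) z -
          op (op y α) (op (op x α) z) =
        op (op y (op (op x α) α)) z := by
  intro x y z
  rw [h_leibniz (op x α) (op y α) z, h_leibniz (op x α) y α, h_add_left]
  abel
end
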